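/- For all terms s and t, the equation s ≈ t holds under every assignment of time warps to variables if, and only if, it holds under every assignment of regular time warps to variables; that is, (∀ h : ℕ → W, eval h s = eval h t) ↔ (∀ h : ℕ → W, (∀ x, h x is regular) → eval h s = eval h t). -/

import Mathlib

/-- A map `f : ℕ∞ → ℕ∞` preserves arbitrary suprema. -/
def PreservesSSup (f : ℕ∞ → ℕ∞) : Prop :=
  ∀ S : Set ℕ∞, f (sSup S) = sSup (f '' S)

/-- The predecessor time warp: `pred 0 = 0`, `pred ⊤ = ⊤`, `pred (n+1) = n`. -/
def wpred (m : ℕ∞) : ℕ∞ := if m = ⊤ then ⊤ else ((m.toNat - 1 : ℕ) : ℕ∞)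

/-- The involution `f⋆` of a time warp `f`: `f⋆ m = ⨅ {pred n | n ∈ ℕ∞, m ≤ f n}`. -/
noncomputable def winv (f : ℕ∞ → ℕ∞) : ℕ∞ → ℕ∞ :=
  fun m => sInf {y | ∃ n : ℕ∞, m ≤ f n ∧ y = wpred n}

/-- `f` is eventually constant: from some `m : ℕ` on, `f` takes the value `f m`. -/
def EventuallyConstant (f : ℕ∞ → ℕ∞) : Prop :=
  ∃ m : ℕ, ∀ n : ℕ, m ≤ n → f n = f m

/-- `f` is eventually linear: there are `m : ℕ` and `k : ℤ` with `f n = n + k`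
for all natural `n ≥ m`. -/
def EventuallyLinear (f : ℕ∞ → ℕ∞) : Prop :=
  ∃ (m : ℕ) (k : ℤ), ∀ n : ℕ, m ≤ n → ∃ j : ℕ, f n = (j : ℕ∞) ∧ (j : ℤ) = (n : ℤ) + k

/-- `f` is regular: eventually constant or eventually linear. -/
def RegularW (f : ℕ∞ → ℕ∞) : Prop := EventuallyConstant f ∨ EventuallyLinear f

/-- Terms in the language of the time warp algebra. -/
inductive Term : Type
  | var : ℕ → Term
  | one : Term
  | mul : Term → Term → Term
  | star : Term → Term
  | meet : Term → Term → Term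
  | join : Term → Term → Term

/-- Evaluation of a term under an assignment `h` of maps to variables. -/
noncomputable def eval (h : ℕ → ℕ∞ → ℕ∞) : Term → ℕ∞ → ℕ∞
  | Term.var i => h i
  | Term.one => id
  | Term.mul t u => eval h t ∘ eval h u
  | Term.star t => winv (eval h t)
  | Term.meet t u => fun x => eval h t x ⊓ eval h u x
  | Term.join t u => fun x => eval h t x ⊔ eval h u x

open Filter

/-- `f` is monotone, finite on `ℕ`, and takes arbitrarily large values on `ℕ`. -/
structure FiniteUnbounded (f : ℕ∞ → ℕ∞) : Prop where
  mono : Monotone f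
  ne_top : ∀ n : ℕ, f n ≠ ⊤
  unbounded : ∀ k : ℕ, ∃ n : ℕ, (k : ℕ∞) ≤ f n

theorem eq_top_of_forall_natCast_le {x : ℕ∞} (h : ∀ k : ℕ, (k : ℕ∞) ≤ x) : x = ⊤ :=
  ENat.eq_top_iff_forall_ge.2 h

namespace FiniteUnbounded

variable {f g : ℕ∞ → ℕ∞}

theorem map_top (hf : FiniteUnbounded f) : f ⊤ = ⊤ :=
  eq_top_of_forall_natCast_le fun k =>
    let ⟨_, hn⟩ := hf.unbounded k
    hn.trans (hf.mono le_top)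

theorem id : FiniteUnbounded id :=
  ⟨monotone_id, fun n => ENat.natCast_ne_top n, fun k => ⟨k, le_rfl⟩⟩

theorem comp (hf : FiniteUnbounded f) (hg : FiniteUnbounded g) : FiniteUnbounded (f ∘ g) := by
  refine ⟨hf.mono.comp hg.mono, fun n => ?_, fun k => ?_⟩
  · obtain ⟨m, hm⟩ := ENat.ne_top_iff_exists.1 (hg.ne_top n)
    rw [Function.comp_apply, ← hm]
    exact hf.ne_top m
  · obtain ⟨m, hm⟩ := hf.unbounded k
    obtain ⟨n, hn⟩ := hg.unbounded m
    exact ⟨n, hm.trans (hf.mono hn)⟩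

theorem inf_of_unbounded (hf : Monotone f) (hfu : ∀ k : ℕ, ∃ n : ℕ, (k : ℕ∞) ≤ f n)
    (hg : FiniteUnbounded g) : FiniteUnbounded (fun x => f x ⊓ g x) := by
  refine ⟨hf.inf hg.mono, fun n => ?_, fun k => ?_⟩
  · exact ((inf_le_right).trans_lt (lt_top_iff_ne_top.2 (hg.ne_top n))).ne
  · obtain ⟨a, ha⟩ := hfu k
    obtain ⟨b, hb⟩ := hg.unbounded k
    refine ⟨max a b, le_inf (ha.trans (hf ?_)) (hb.trans (hg.mono ?_))⟩ <;> simp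

theorem sup_of_ne_top (hf : Monotone f) (hft : ∀ n : ℕ, f n ≠ ⊤)
    (hg : FiniteUnbounded g) : FiniteUnbounded (fun x => f x ⊔ g x) := by
  refine ⟨hf.sup hg.mono, fun n => ?_, fun k => ?_⟩
  · exact (max_lt (lt_top_iff_ne_top.2 (hft n)) (lt_top_iff_ne_top.2 (hg.ne_top n))).ne
  · obtain ⟨b, hb⟩ := hg.unbounded k
    exact ⟨b, hb.trans le_sup_right⟩

theorem preservesSSup (hf : FiniteUnbounded f) (h0 : f 0 = 0) : PreservesSSup f := by
  intro S
  by_cases htop : sSup S = ⊤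
  · rw [htop, hf.map_top]
    refine (eq_top_of_forall_natCast_le fun k => ?_).symm
    obtain ⟨n, hn⟩ := hf.unbounded k
    have hlt : (n : ℕ∞) < sSup S := htop ▸ ENat.natCast_lt_top n
    obtain ⟨s, hs, hns⟩ := lt_sSup_iff.1 hlt
    exact (hn.trans (hf.mono hns.le)).trans (le_sSup (Set.mem_image_of_mem f hs))
  · rcases S.eq_empty_or_nonempty with rfl | hne
    · simpa using h0
    · have := hne.to_subtype
      have hmem : sSup S ∈ S := ENat.sSup_mem_of_nonempty_of_lt_top (lt_top_iff_ne_top.2 htop)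
      refine le_antisymm (le_sSup (Set.mem_image_of_mem f hmem)) (sSup_le ?_)
      rintro _ ⟨s, hs, rfl⟩
      exact hf.mono (le_sSup hs)

end FiniteUnbounded

theorem PreservesSSup.map_zero {f : ℕ∞ → ℕ∞} (hf : PreservesSSup f) : f 0 = 0 := by
  simpa using hf ∅

theorem PreservesSSup.monotone {f : ℕ∞ → ℕ∞} (hf : PreservesSSup f) : Monotone f := by
  intro a b hab
  have h := hf {a, b}
  rw [sSup_pair, sup_eq_right.2 hab] at h
  rw [h]
  exact le_sSup ⟨a, by simp, rfl⟩

theorem PreservesSSup.map_top_le {f : ℕ∞ → ℕ∞} (hf : PreservesSSup f) {c : ℕ∞}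
    (hc : ∀ n : ℕ, f n ≤ c) : f ⊤ ≤ c := by
  have hsup : sSup (Set.range ((↑) : ℕ → ℕ∞)) = ⊤ :=
    eq_top_of_forall_natCast_le fun k => le_sSup ⟨k, rfl⟩
  rw [← hsup, hf]
  refine sSup_le ?_
  rintro _ ⟨_, ⟨n, rfl⟩, rfl⟩
  exact hc n

/-- A time warp that does not attain its supremum at a finite point is finite and unbounded
on `ℕ`. -/
theorem PreservesSSup.finiteUnbounded {f : ℕ∞ → ℕ∞} (hf : PreservesSSup f)
    (hne : ¬ ∃ K : ℕ, f ⊤ = f K) : FiniteUnbounded f := by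
  have hlt : ∀ n : ℕ, f n < f ⊤ := fun n =>
    lt_of_le_of_ne (hf.monotone le_top) fun h => hne ⟨n, h.symm⟩
  have htop : f ⊤ = ⊤ := by
    by_contra h
    obtain ⟨c, hc⟩ := ENat.ne_top_iff_exists.1 h
    have hpos : 0 < c := by
      have := (zero_le (a := f (0 : ℕ))).trans_lt (hlt 0)
      rw [← hc] at this
      exact_mod_cast this
    have hle : f ⊤ ≤ ((c - 1 : ℕ) : ℕ∞) := hf.map_top_le fun n => by
      obtain ⟨m, hm⟩ := ENat.ne_top_iff_exists.1 ((hlt n).trans_le le_top).ne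
      have := hlt n
      rw [← hm, ← hc] at this
      rw [← hm]
      have : m < c := by exact_mod_cast this
      exact_mod_cast Nat.le_sub_one_of_lt this
    rw [← hc] at hle
    have : c ≤ c - 1 := by exact_mod_cast hle
    omega
  refine ⟨hf.monotone, fun n => ((hlt n).trans_le le_top).ne, fun k => ?_⟩
  by_contra! h
  have := hf.map_top_le fun n => (h n).le
  rw [htop] at this
  exact ENat.natCast_ne_top k (top_le_iff.1 this)

theorem wpred_mono : Monotone wpred := by
  intro a b hab
  unfold wpred
  induction b with
  | top => simp
  | coe b =>
    induction a with
    | top => simp at hab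
    | coe a =>
      have : a ≤ b := by exact_mod_cast hab
      simp only [ENat.natCast_ne_top, if_false, ENat.toNat_natCast, Nat.cast_le]
      omega

theorem wpred_natCast (n : ℕ) : wpred n = ((n - 1 : ℕ) : ℕ∞) := by
  simp [wpred]

theorem natCast_le_wpred {k : ℕ} {y : ℕ∞} (h : (k : ℕ∞) < y) : (k : ℕ∞) ≤ wpred y := by
  have h1 : ((k + 1 : ℕ) : ℕ∞) ≤ y := by
    push_cast
    exact Order.add_one_le_of_lt h
  exact (wpred_natCast (k + 1)).ge.trans (wpred_mono h1)

theorem winv_le {f : ℕ∞ → ℕ∞} {m n : ℕ∞} (h : m ≤ f n) : winv f m ≤ wpred n :=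
  sInf_le ⟨n, h, rfl⟩

theorem le_winv {f : ℕ∞ → ℕ∞} {m c : ℕ∞} (h : ∀ n, m ≤ f n → c ≤ wpred n) : c ≤ winv f m :=
  le_sInf fun _ ⟨n, hn, hy⟩ => hy ▸ h n hn

theorem winv_mono (f : ℕ∞ → ℕ∞) : Monotone (winv f) := fun _ _ hab =>
  le_winv fun _ hn => winv_le (hab.trans hn)

theorem natCast_le_winv {f : ℕ∞ → ℕ∞} (hf : Monotone f) {k : ℕ} {m : ℕ∞} (h : f k < m) :
    (k : ℕ∞) ≤ winv f m :=
  le_winv fun _ hn => natCast_le_wpred (lt_of_not_ge fun hle => (h.trans_le hn).not_ge (hf hle))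

theorem winv_le_winv_of_agree {f g : ℕ∞ → ℕ∞} {m n : ℕ∞} (hm : m ≤ f n)
    (h : ∀ x ≤ n, g x = f x) : winv f m ≤ winv g m :=
  le_winv fun y hy => by
    rcases le_total y n with hyn | hyn
    · exact winv_le (h y hyn ▸ hy)
    · exact (winv_le hm).trans (wpred_mono hyn)

theorem winv_eq_of_agree {f g : ℕ∞ → ℕ∞} {m n : ℕ∞} (hm : m ≤ f n)
    (h : ∀ x ≤ n, g x = f x) : winv g m = winv f m :=
  le_antisymm (winv_le_winv_of_agree (h n le_rfl ▸ hm) fun x hx => (h x hx).symm)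
    (winv_le_winv_of_agree hm h)

theorem FiniteUnbounded.winv {f : ℕ∞ → ℕ∞} (hf : FiniteUnbounded f) :
    FiniteUnbounded (winv f) := by
  refine ⟨winv_mono f, fun m => ?_, fun k => ?_⟩
  · obtain ⟨n, hn⟩ := hf.unbounded m
    refine ((winv_le hn).trans_lt ?_).ne
    rw [wpred_natCast]
    exact ENat.natCast_lt_top _
  · obtain ⟨m, hm⟩ := ENat.ne_top_iff_exists.1 (hf.ne_top k)
    refine ⟨m + 1, natCast_le_winv hf.mono ?_⟩
    rw [← hm]
    exact_mod_cast Nat.lt_succ_self m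

theorem exists_winv_top_eq {f : ℕ∞ → ℕ∞} (hf : Monotone f) {K : ℕ} (hK : f ⊤ = f K) :
    ∃ L : ℕ, winv f ⊤ = winv f L := by
  classical
  suffices h : ∃ L : ℕ, winv f ⊤ ≤ winv f L from
    h.imp fun L hL => le_antisymm hL (winv_mono f le_top)
  by_cases htop : f K = ⊤
  · have hex : ∃ n : ℕ, f n = ⊤ := ⟨K, htop⟩
    have hfind : winv f ⊤ ≤ ((Nat.find hex - 1 : ℕ) : ℕ∞) := by
      rw [← wpred_natCast]
      exact winv_le (Nat.find_spec hex).ge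
    rcases Nat.eq_zero_or_pos (Nat.find hex) with h0 | hpos
    · refine ⟨0, hfind.trans ?_⟩
      simp [h0]
    · have hne : f ((Nat.find hex - 1 : ℕ) : ℕ∞) ≠ ⊤ :=
        Nat.find_min hex (Nat.sub_lt hpos Nat.one_pos)
      obtain ⟨c, hc⟩ := ENat.ne_top_iff_exists.1 hne
      refine ⟨c + 1, hfind.trans (natCast_le_winv hf ?_)⟩
      rw [← hc]
      exact_mod_cast Nat.lt_succ_self c
  · obtain ⟨c, hc⟩ := ENat.ne_top_iff_exists.1 htop
    refine ⟨c + 1, le_winv fun n hn => absurd (hn.trans (hf le_top)) ?_⟩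
    rw [hK, ← hc, not_le]
    exact_mod_cast Nat.lt_succ_self c

/-- The sequence `F` of monotone maps converges pointwise to `f` on `ℕ`, and `f` either attains
its supremum at a finite point uniformly along `F`, or is finite and unbounded on `ℕ` together
with almost all members of `F`. -/
structure TailConverges (F : ℕ → ℕ∞ → ℕ∞) (f : ℕ∞ → ℕ∞) : Prop where
  mono : Monotone f
  eventually_mono : ∀ᶠ N in atTop, Monotone (F N)
  eventually_eq_natCast : ∀ n : ℕ, ∀ᶠ N in atTop, F N n = f n
  tail : (∃ K : ℕ, f ⊤ = f K ∧ ∀ᶠ N in atTop, F N ⊤ = F N K) ∨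
    (FiniteUnbounded f ∧ ∀ᶠ N in atTop, FiniteUnbounded (F N))

namespace TailConverges

variable {F G : ℕ → ℕ∞ → ℕ∞} {f g : ℕ∞ → ℕ∞}

theorem eventually_eq_apply (h : TailConverges F f) (x : ℕ∞) : ∀ᶠ N in atTop, F N x = f x := by
  induction x with
  | coe n => exact h.eventually_eq_natCast n
  | top =>
    rcases h.tail with ⟨K, hK, hFK⟩ | ⟨hf, hF⟩
    · filter_upwards [hFK, h.eventually_eq_natCast K] with N h1 h2
      rw [h1, h2, hK]
    · filter_upwards [hF] with N hN
      rw [hN.map_top, hf.map_top]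

theorem eventually_eq_of_le (h : TailConverges F f) (n : ℕ) :
    ∀ᶠ N in atTop, ∀ x ≤ (n : ℕ∞), F N x = f x := by
  have := (Set.finite_Iic n).eventually_all.2 fun m _ => h.eventually_eq_natCast m
  filter_upwards [this] with N hN x hx
  obtain ⟨m, rfl⟩ := ENat.ne_top_iff_exists.1 (hx.trans_lt (ENat.natCast_lt_top n)).ne
  exact hN m (by exact_mod_cast hx)

theorem eventually_eq (h : TailConverges F f) {K : ℕ} (hK : f ⊤ = f K)
    (hFK : ∀ᶠ N in atTop, F N ⊤ = F N K) : ∀ᶠ N in atTop, F N = f := by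
  filter_upwards [hFK, h.eventually_mono, h.eventually_eq_of_le K] with N h1 h2 h3
  funext x
  rcases le_total x K with hx | hx
  · exact h3 x hx
  · have e1 : F N x = F N K := le_antisymm ((h2 le_top).trans_eq h1) (h2 hx)
    have e2 : f x = f K := le_antisymm ((h.mono le_top).trans_eq hK) (h.mono hx)
    rw [e1, e2, h3 K le_rfl]

theorem of_eventually_eq (hf : Monotone f) {K : ℕ} (hK : f ⊤ = f K)
    (hF : ∀ᶠ N in atTop, F N = f) : TailConverges F f where
  mono := hf
  eventually_mono := hF.mono fun _ hN => hN ▸ hf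
  eventually_eq_natCast _ := hF.mono fun _ hN => hN ▸ rfl
  tail := .inl ⟨K, hK, hF.mono fun _ hN => hN ▸ hK⟩

theorem of_finiteUnbounded (hf : FiniteUnbounded f) (hF : ∀ᶠ N in atTop, FiniteUnbounded (F N))
    (h : ∀ n : ℕ, ∀ᶠ N in atTop, F N n = f n) : TailConverges F f :=
  ⟨hf.mono, hF.mono fun _ hN => hN.mono, h, .inr ⟨hf, hF⟩⟩

theorem comp (hF : TailConverges F f) (hG : TailConverges G g) :
    TailConverges (fun N => F N ∘ G N) (f ∘ g) where
  mono := hF.mono.comp hG.mono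
  eventually_mono := by
    filter_upwards [hF.eventually_mono, hG.eventually_mono] with N h1 h2 using h1.comp h2
  eventually_eq_natCast n := by
    filter_upwards [hG.eventually_eq_natCast n, hF.eventually_eq_apply (g n)] with N h1 h2
    simp [h1, h2]
  tail := by
    rcases hG.tail with ⟨K, hK, hGK⟩ | ⟨hg, hG'⟩
    · refine .inl ⟨K, by simp [hK], hGK.mono fun N hN => by simp [hN]⟩
    rcases hF.tail with ⟨K, hK, hFK⟩ | ⟨hf, hF'⟩
    · obtain ⟨n, hn⟩ := hg.unbounded K
      have key : f (g ⊤) = f (g n) := by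
        rw [hg.map_top]
        exact le_antisymm (hK.le.trans (hF.mono hn)) (hF.mono le_top)
      refine .inl ⟨n, key, ?_⟩
      filter_upwards [hF.eventually_eq hK hFK, hG', hG.eventually_eq_natCast n] with N h1 h2 h3
      simp only [Function.comp_apply]
      rw [h1, h2.map_top, h3, ← key, hg.map_top]
    · refine .inr ⟨hf.comp hg, ?_⟩
      filter_upwards [hF', hG'] with N h1 h2 using h1.comp h2

theorem winv (hF : TailConverges F f) : TailConverges (fun N => winv (F N)) (winv f) := by
  rcases hF.tail with ⟨K, hK, hFK⟩ | ⟨hf, hF'⟩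
  · obtain ⟨L, hL⟩ := exists_winv_top_eq hF.mono hK
    exact of_eventually_eq (winv_mono f) hL ((hF.eventually_eq hK hFK).mono fun N hN => by rw [hN])
  · refine of_finiteUnbounded hf.winv (hF'.mono fun N hN => hN.winv) fun m => ?_
    obtain ⟨n, hn⟩ := hf.unbounded m
    filter_upwards [hF.eventually_eq_of_le n] with N hN using winv_eq_of_agree hn hN

theorem inf_of_attained (hF : TailConverges F f) (hG : TailConverges G g) {K : ℕ}
    (hK : f ⊤ = f K) (hFK : ∀ᶠ N in atTop, F N ⊤ = F N K) (hg : FiniteUnbounded g)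
    (hG' : ∀ᶠ N in atTop, FiniteUnbounded (G N)) :
    TailConverges (fun N x => F N x ⊓ G N x) (fun x => f x ⊓ g x) := by
  have hFe := hF.eventually_eq hK hFK
  have hpt : ∀ n : ℕ, ∀ᶠ N in atTop, F N n ⊓ G N n = f n ⊓ g n := fun n => by
    filter_upwards [hFe, hG.eventually_eq_natCast n] with N h1 h2
    rw [h1, h2]
  by_cases htop : f K = ⊤
  · have hfu : ∀ k : ℕ, ∃ n : ℕ, (k : ℕ∞) ≤ f n := fun k => ⟨K, htop ▸ le_top⟩
    refine of_finiteUnbounded (.inf_of_unbounded hF.mono hfu hg) ?_ hpt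
    filter_upwards [hFe, hG'] with N h1 h2
    rw [h1]
    exact .inf_of_unbounded hF.mono hfu h2
  · obtain ⟨c, hc⟩ := ENat.ne_top_iff_exists.1 htop
    obtain ⟨n, hn⟩ := hg.unbounded c
    have hn' : f K ≤ g (max K n : ℕ) := hc ▸ hn.trans (hg.mono (by simp))
    have hfm : f (max K n : ℕ) = f K :=
      le_antisymm ((hF.mono le_top).trans_eq hK) (hF.mono (by simp))
    refine ⟨hF.mono.inf hg.mono, ?_, hpt, .inl ⟨max K n, ?_, ?_⟩⟩
    · filter_upwards [hF.eventually_mono, hG.eventually_mono] with N h1 h2 using h1.inf h2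
    · simp only [hg.map_top, hfm, hK, inf_top_eq, inf_eq_left.2 hn']
    · filter_upwards [hFe, hG', hG.eventually_eq_natCast (max K n)] with N h1 h2 h3
      simp only [h1, h3, h2.map_top, hfm, hK, inf_top_eq, inf_eq_left.2 hn']

theorem sup_of_attained (hF : TailConverges F f) (hG : TailConverges G g) {K : ℕ}
    (hK : f ⊤ = f K) (hFK : ∀ᶠ N in atTop, F N ⊤ = F N K) (hg : FiniteUnbounded g)
    (hG' : ∀ᶠ N in atTop, FiniteUnbounded (G N)) :
    TailConverges (fun N x => F N x ⊔ G N x) (fun x => f x ⊔ g x) := by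
  have hFe := hF.eventually_eq hK hFK
  have hpt : ∀ n : ℕ, ∀ᶠ N in atTop, F N n ⊔ G N n = f n ⊔ g n := fun n => by
    filter_upwards [hFe, hG.eventually_eq_natCast n] with N h1 h2
    rw [h1, h2]
  by_cases htop : f K = ⊤
  · refine ⟨hF.mono.sup hg.mono, ?_, hpt, .inl ⟨K, by simp [hK, htop], ?_⟩⟩
    · filter_upwards [hF.eventually_mono, hG.eventually_mono] with N h1 h2 using h1.sup h2
    · filter_upwards [hFe] with N h1
      simp [h1, hK, htop]
  · have hft : ∀ n : ℕ, f n ≠ ⊤ := fun n =>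
      (((hF.mono le_top).trans_eq hK).trans_lt (lt_top_iff_ne_top.2 htop)).ne
    refine of_finiteUnbounded (.sup_of_ne_top hF.mono hft hg) ?_ hpt
    filter_upwards [hFe, hG'] with N h1 h2
    rw [h1]
    exact .sup_of_ne_top hF.mono hft h2

theorem inf (hF : TailConverges F f) (hG : TailConverges G g) :
    TailConverges (fun N x => F N x ⊓ G N x) (fun x => f x ⊓ g x) := by
  rcases hF.tail with ⟨K, hK, hFK⟩ | ⟨hf, hF'⟩ <;> rcases hG.tail with ⟨L, hL, hGL⟩ | ⟨hg, hG'⟩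
  · have hm : f ⊤ ⊓ g ⊤ = f (max K L : ℕ) ⊓ g (max K L : ℕ) := by
      refine le_antisymm (inf_le_inf ?_ ?_) (inf_le_inf (hF.mono le_top) (hG.mono le_top))
      · exact hK.trans_le (hF.mono (by simp))
      · exact hL.trans_le (hG.mono (by simp))
    refine of_eventually_eq (hF.mono.inf hG.mono) hm ?_
    filter_upwards [hF.eventually_eq hK hFK, hG.eventually_eq hL hGL] with N h1 h2
    rw [h1, h2]
  · exact hF.inf_of_attained hG hK hFK hg hG'
  · simpa only [inf_comm] using hG.inf_of_attained hF hL hGL hf hF'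
  · refine of_finiteUnbounded (.inf_of_unbounded hf.mono hf.unbounded hg) ?_ fun n => ?_
    · filter_upwards [hF', hG'] with N h1 h2 using .inf_of_unbounded h1.mono h1.unbounded h2
    · filter_upwards [hF.eventually_eq_natCast n, hG.eventually_eq_natCast n] with N h1 h2
      rw [h1, h2]

theorem sup (hF : TailConverges F f) (hG : TailConverges G g) :
    TailConverges (fun N x => F N x ⊔ G N x) (fun x => f x ⊔ g x) := by
  rcases hF.tail with ⟨K, hK, hFK⟩ | ⟨hf, hF'⟩ <;> rcases hG.tail with ⟨L, hL, hGL⟩ | ⟨hg, hG'⟩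
  · have hm : f ⊤ ⊔ g ⊤ = f (max K L : ℕ) ⊔ g (max K L : ℕ) := by
      refine le_antisymm (sup_le_sup ?_ ?_) (sup_le_sup (hF.mono le_top) (hG.mono le_top))
      · exact hK.trans_le (hF.mono (by simp))
      · exact hL.trans_le (hG.mono (by simp))
    refine of_eventually_eq (hF.mono.sup hG.mono) hm ?_
    filter_upwards [hF.eventually_eq hK hFK, hG.eventually_eq hL hGL] with N h1 h2
    rw [h1, h2]
  · exact hF.sup_of_attained hG hK hFK hg hG'
  · simpa only [sup_comm] using hG.sup_of_attained hF hL hGL hf hF'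
  · refine of_finiteUnbounded (.sup_of_ne_top hf.mono hf.ne_top hg) ?_ fun n => ?_
    · filter_upwards [hF', hG'] with N h1 h2 using .sup_of_ne_top h1.mono h1.ne_top h2
    · filter_upwards [hF.eventually_eq_natCast n, hG.eventually_eq_natCast n] with N h1 h2
      rw [h1, h2]

theorem eval {H : ℕ → ℕ → ℕ∞ → ℕ∞} {h : ℕ → ℕ∞ → ℕ∞}
    (hH : ∀ i, TailConverges (fun N => H N i) (h i)) :
    ∀ t : Term, TailConverges (fun N => eval (H N) t) (eval h t)
  | .var i => hH i
  | .one => of_finiteUnbounded .id (.of_forall fun _ => .id) fun _ => .of_forall fun _ => rfl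
  | .mul t u => (TailConverges.eval hH t).comp (TailConverges.eval hH u)
  | .star t => (TailConverges.eval hH t).winv
  | .meet t u => (TailConverges.eval hH t).inf (TailConverges.eval hH u)
  | .join t u => (TailConverges.eval hH t).sup (TailConverges.eval hH u)

end TailConverges

/-- The map that agrees with `f` up to `N` and grows with slope one from there on. -/
noncomputable def linearTail (f : ℕ∞ → ℕ∞) (N : ℕ) : ℕ∞ → ℕ∞ :=
  fun x => f (min x N) + (x - N)

theorem linearTail_of_le (f : ℕ∞ → ℕ∞) {N : ℕ} {x : ℕ∞} (hx : x ≤ N) :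
    linearTail f N x = f x := by
  simp [linearTail, min_eq_left hx, tsub_eq_zero_of_le hx]

theorem FiniteUnbounded.linearTail {f : ℕ∞ → ℕ∞} (hf : FiniteUnbounded f) (N : ℕ) :
    FiniteUnbounded (linearTail f N) := by
  refine ⟨fun x y hxy => ?_, fun n => ?_, fun k => ⟨k + N, ?_⟩⟩
  · exact add_le_add (hf.mono (min_le_min_right _ hxy)) (tsub_le_tsub_right hxy _)
  · have h1 : f (min (n : ℕ∞) N) ≠ ⊤ := by
      rcases min_choice (n : ℕ∞) N with h | h <;> rw [h] <;> exact hf.ne_top _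
    have h2 : (n : ℕ∞) - N ≠ ⊤ := by
      rw [← ENat.natCast_sub]
      exact ENat.natCast_ne_top _
    exact WithTop.add_ne_top.2 ⟨h1, h2⟩
  · refine le_trans ?_ le_add_self
    rw [← ENat.natCast_sub, Nat.add_sub_cancel]

theorem FiniteUnbounded.eventuallyLinear_linearTail {f : ℕ∞ → ℕ∞} (hf : FiniteUnbounded f)
    (N : ℕ) : EventuallyLinear (_root_.linearTail f N) := by
  obtain ⟨c, hc⟩ := ENat.ne_top_iff_exists.1 (hf.ne_top N)
  refine ⟨N, (c : ℤ) - N, fun n hn => ⟨c + (n - N), ?_, ?_⟩⟩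
  · have : min (n : ℕ∞) N = N := min_eq_right (by exact_mod_cast hn)
    simp [_root_.linearTail, this, hc]
  · omega

/-- Every time warp is approximated by regular time warps. -/
theorem PreservesSSup.exists_regular_tailConverges {f : ℕ∞ → ℕ∞} (hf : PreservesSSup f) :
    ∃ F : ℕ → ℕ∞ → ℕ∞, (∀ N, PreservesSSup (F N)) ∧ (∀ N, RegularW (F N)) ∧
      TailConverges F f := by
  by_cases h : ∃ K : ℕ, f ⊤ = f K
  · obtain ⟨K, hK⟩ := h
    refine ⟨fun _ => f, fun _ => hf, fun _ => .inl ⟨K, fun n hn => ?_⟩,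
      .of_eventually_eq hf.monotone hK (.of_forall fun _ => rfl)⟩
    exact le_antisymm ((hf.monotone le_top).trans_eq hK) (hf.monotone (by exact_mod_cast hn))
  · have hu := hf.finiteUnbounded h
    refine ⟨linearTail f, fun N => (hu.linearTail N).preservesSSup ?_,
      fun N => .inr (hu.eventuallyLinear_linearTail N),
      .of_finiteUnbounded hu (.of_forall hu.linearTail) fun n => ?_⟩
    · rw [linearTail_of_le f (zero_le), hf.map_zero]
    · filter_upwards [eventually_ge_atTop n] with N hN
      exact linearTail_of_le f (by exact_mod_cast hN)

/-- An equation holds under all assignments of time warps if, and only if, it holds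
under all assignments of regular time warps. -/
theorem stmt17 (s t : Term) :
    (∀ h : ℕ → ℕ∞ → ℕ∞, (∀ i, PreservesSSup (h i)) → eval h s = eval h t) ↔
    (∀ h : ℕ → ℕ∞ → ℕ∞, (∀ i, PreservesSSup (h i)) → (∀ i, RegularW (h i)) →
      eval h s = eval h t) := by
  refine ⟨fun H h hh _ => H h hh, fun H h hh => funext fun x => ?_⟩
  choose F hF hreg hconv using fun i => (hh i).exists_regular_tailConverges
  have key := TailConverges.eval (H := fun N i => F i N) hconv
  obtain ⟨N, hs, ht⟩ :=
    (((key s).eventually_eq_apply x).and ((key t).eventually_eq_apply x)).exists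
  rw [← hs, ← ht, H _ (fun i => hF i N) fun i => hreg i N]
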